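/- Let w ≡ 1 on [-1,1], let Q[f] = Σ_{j=1}^ℓ a_j f(x_j) be a quadrature formula with nodes -1 ≤ x_1 < ... < x_ℓ ≤ 1 and real weights a_j, and assume Q[p] = ∫_{-1}^1 p(x) dx for every polynomial p of degree at most m, for some m ∈ ℕ₀. Let Q^{(n)} denote the n-fold compound quadrature formula built from Q, i.e., Q^{(n)}[f] := (1/n) Σ_{ν=1}^n Σ_{j=1}^ℓ a_j f(-1 + (x_j + 2ν - 1)/n). Then for every s ∈ {0,1,...,m} there exists a constant C, depending only on Q and s, such that for all f ∈ V_s one has |∫_{-1}^1 f(x) dx − Q^{(n)}[f]| ≤ C n^{-s-1} · Var f^{(s)}, where Var g denotes the total variation of g over [-1,1]. -/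

import Mathlib

open MeasureTheory Finset

/-- The total variation of `g` over the interval `[a, b]`. -/
noncomputable def totalVar (g : ℝ → ℝ) (a b : ℝ) : ℝ :=
  (eVariationOn g (Set.Icc a b)).toReal

/-- `g` is absolutely continuous on the interval `[a, b]`:  for every `ε > 0` there is
`δ > 0` such that for every finite collection of non-overlapping subintervals
`[c i, d i]` of `[a, b]` of total length `< δ`, the sum `∑ |g (d i) - g (c i)| < ε`. -/
def AbsContOn (g : ℝ → ℝ) (a b : ℝ) : Prop :=
  ∀ ε > 0, ∃ δ > 0, ∀ (k : ℕ) (c d : Fin k → ℝ),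
    (∀ i, c i ∈ Set.Icc a b ∧ d i ∈ Set.Icc a b ∧ c i ≤ d i) →
    (Pairwise fun i j => Disjoint (Set.Ioo (c i) (d i)) (Set.Ioo (c j) (d j))) →
    (∑ i, (d i - c i)) < δ → (∑ i, |g (d i) - g (c i)|) < ε

/-- Membership in the class `V s` over the interval `[a, b]`:  for `s = 0` it means that
`g` has bounded (total) variation on `[a, b]`; for `s ≥ 1` it means that the derivatives
of `g` up to order `s` exist on `[a, b]`, that `g^{(s-1)}` is absolutely continuous on
`[a, b]`, and that `g^{(s)}` has bounded variation on `[a, b]`. -/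
def MemV (s : ℕ) (g : ℝ → ℝ) (a b : ℝ) : Prop :=
  match s with
  | 0 => BoundedVariationOn g (Set.Icc a b)
  | t + 1 =>
      (∀ i ≤ t, DifferentiableOn ℝ (iteratedDerivWithin i g (Set.Icc a b)) (Set.Icc a b)) ∧
      AbsContOn (iteratedDerivWithin t g (Set.Icc a b)) a b ∧
      BoundedVariationOn (iteratedDerivWithin (t + 1) g (Set.Icc a b)) (Set.Icc a b)

/-- Every real polynomial has an antiderivative of degree at most one larger. -/
theorem Polynomial.exists_derivative_eq_of_natDegree_le (q : Polynomial ℝ) {n : ℕ}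
    (hq : q.natDegree ≤ n) :
    ∃ p : Polynomial ℝ, p.natDegree ≤ n + 1 ∧ Polynomial.derivative p = q := by
  refine ⟨∑ i ∈ Finset.range (n + 1), Polynomial.monomial (i + 1) (q.coeff i / ((i : ℝ) + 1)),
    ?_, ?_⟩
  · refine Polynomial.natDegree_sum_le_of_forall_le _ _ fun i hi => ?_
    have := Finset.mem_range.1 hi
    exact (Polynomial.natDegree_monomial_le _).trans (by omega)
  · rw [map_sum]
    conv_rhs => rw [q.as_sum_range' (n + 1) (by omega)]
    refine Finset.sum_congr rfl fun i _ => ?_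
    rw [Polynomial.derivative_monomial]
    have : (i : ℝ) + 1 ≠ 0 := by positivity
    congr 1
    push_cast
    field_simp

/-- If `F 0, …, F s` are successive derivatives on `[α, β]` and `F s` has bounded variation there,
then `F 0` is approximated by a polynomial of degree at most `s` up to `Var (F s) * (β - α) ^ s`. -/
theorem exists_polynomial_abs_sub_le {α β : ℝ} (hαβ : α ≤ β) (s : ℕ) (F : ℕ → ℝ → ℝ)
    (hF : ∀ i < s, ∀ x ∈ Set.Icc α β, HasDerivWithinAt (F i) (F (i + 1) x) (Set.Icc α β) x)
    (hV : BoundedVariationOn (F s) (Set.Icc α β)) :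
    ∃ p : Polynomial ℝ, p.natDegree ≤ s ∧
      ∀ x ∈ Set.Icc α β, |F 0 x - p.eval x| ≤ totalVar (F s) α β * (β - α) ^ s := by
  induction s generalizing F with
  | zero =>
    refine ⟨Polynomial.C (F 0 α), by simp, fun x hx => ?_⟩
    simpa [Real.dist_eq, totalVar] using hV.dist_le hx (Set.left_mem_Icc.2 hαβ)
  | succ s ih =>
    obtain ⟨q, hqd, hq⟩ := ih (fun i => F (i + 1)) (fun i hi => hF (i + 1) (by omega)) hV
    obtain ⟨r, hrd, rfl⟩ := q.exists_derivative_eq_of_natDegree_le hqd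
    refine ⟨r + Polynomial.C (F 0 α - r.eval α), ?_, fun x hx => ?_⟩
    · exact (Polynomial.natDegree_add_C).trans_le hrd
    · have hd : ∀ y ∈ Set.Icc α β, HasDerivWithinAt (fun y => F 0 y - r.eval y)
          (F 1 y - (Polynomial.derivative r).eval y) (Set.Icc α β) y := fun y hy =>
        (hF 0 (by omega) y hy).sub (r.hasDerivAt y).hasDerivWithinAt
      have key := (convex_Icc α β).norm_image_sub_le_of_norm_hasDerivWithin_le hd hq
        (Set.left_mem_Icc.2 hαβ) hx
      have hnn : 0 ≤ totalVar (F (s + 1)) α β * (β - α) ^ s :=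
        mul_nonneg ENNReal.toReal_nonneg (pow_nonneg (by linarith) _)
      rw [Real.norm_eq_abs, Real.norm_eq_abs, abs_of_nonneg (sub_nonneg.2 hx.1)] at key
      calc |F 0 x - (r + Polynomial.C (F 0 α - r.eval α)).eval x|
          = |F 0 x - r.eval x - (F 0 α - r.eval α)| := by
            rw [Polynomial.eval_add, Polynomial.eval_C]; congr 1; ring
        _ ≤ totalVar (F (s + 1)) α β * (β - α) ^ s * (x - α) := key
        _ ≤ totalVar (F (s + 1)) α β * (β - α) ^ s * (β - α) := by
            gcongr; exact hx.2
        _ = _ := by ring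

/-- Exactness of a quadrature formula is preserved by affine changes of variable. -/
theorem quadrature_exact_affine {l m : ℕ} {x a : Fin l → ℝ}
    (h_exact : ∀ p : Polynomial ℝ, p.degree ≤ (m : WithBot ℕ) →
      ∑ j, a j * p.eval (x j) = ∫ t in (-1 : ℝ)..1, p.eval t)
    (c h : ℝ) (p : Polynomial ℝ) (hp : p.natDegree ≤ m) :
    ∫ t in (c - h)..(c + h), p.eval t = h * ∑ j, a j * p.eval (c + h * x j) := by
  have hdeg : (p.comp (Polynomial.C c + Polynomial.C h * Polynomial.X)).degree
      ≤ (m : WithBot ℕ) := by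
    refine Polynomial.degree_le_of_natDegree_le (Polynomial.natDegree_comp_le.trans ?_)
    have h1 : (Polynomial.C c + Polynomial.C h * Polynomial.X).natDegree ≤ 1 := by
      rw [add_comm]; exact Polynomial.natDegree_linear_le
    nlinarith
  have h2 := h_exact _ hdeg
  simp only [Polynomial.eval_comp, Polynomial.eval_add, Polynomial.eval_mul, Polynomial.eval_C,
    Polynomial.eval_X] at h2
  rw [h2]
  have h3 := intervalIntegral.smul_integral_comp_add_mul (a := -1) (b := 1)
    (fun t => p.eval t) h c
  rw [smul_eq_mul] at h3
  rw [h3]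
  congr 1 <;> ring

/-- Error of a quadrature formula transported to `[c - h, c + h]`, for a function uniformly close
to a polynomial integrated exactly. -/
theorem abs_integral_sub_quadrature_le {l m : ℕ} {x a : Fin l → ℝ}
    (hx_mem : ∀ j, x j ∈ Set.Icc (-1 : ℝ) 1)
    (h_exact : ∀ p : Polynomial ℝ, p.degree ≤ (m : WithBot ℕ) →
      ∑ j, a j * p.eval (x j) = ∫ t in (-1 : ℝ)..1, p.eval t)
    {c h ε : ℝ} (hh : 0 ≤ h) {f : ℝ → ℝ} (hf : IntervalIntegrable f volume (c - h) (c + h))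
    {p : Polynomial ℝ} (hp : p.natDegree ≤ m)
    (hfp : ∀ t ∈ Set.Icc (c - h) (c + h), |f t - p.eval t| ≤ ε) :
    |(∫ t in (c - h)..(c + h), f t) - h * ∑ j, a j * f (c + h * x j)|
      ≤ (2 + ∑ j, |a j|) * (h * ε) := by
  have hsplit : (∫ t in (c - h)..(c + h), f t) - h * ∑ j, a j * f (c + h * x j)
      = (∫ t in (c - h)..(c + h), (f t - p.eval t))
        - h * ∑ j, a j * (f (c + h * x j) - p.eval (c + h * x j)) := by
    rw [intervalIntegral.integral_sub hf (p.continuous.intervalIntegrable _ _),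
      quadrature_exact_affine h_exact c h p hp]
    simp only [mul_sub, Finset.sum_sub_distrib]
    ring
  have hint : |∫ t in (c - h)..(c + h), (f t - p.eval t)| ≤ ε * (2 * h) := by
    have := intervalIntegral.norm_integral_le_of_norm_le_const (a := c - h) (b := c + h)
      (f := fun t => f t - p.eval t) (C := ε) fun t ht => by
        rw [Set.uIoc_of_le (by linarith)] at ht
        exact hfp t (Set.Ioc_subset_Icc_self ht)
    rwa [Real.norm_eq_abs, abs_of_nonneg (by linarith : 0 ≤ c + h - (c - h)),
      show c + h - (c - h) = 2 * h by ring] at this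
  have hsum : |∑ j, a j * (f (c + h * x j) - p.eval (c + h * x j))| ≤ (∑ j, |a j|) * ε := by
    rw [Finset.sum_mul]
    refine (Finset.abs_sum_le_sum_abs _ _).trans (Finset.sum_le_sum fun j _ => ?_)
    rw [abs_mul]
    refine mul_le_mul_of_nonneg_left (hfp _ ?_) (abs_nonneg _)
    constructor <;> nlinarith [(hx_mem j).1, (hx_mem j).2]
  rw [hsplit]
  refine (abs_sub _ _).trans ?_
  rw [abs_mul, abs_of_nonneg hh]
  nlinarith [mul_le_mul_of_nonneg_left hsum hh]

theorem BoundedVariationOn.intervalIntegrable {f : ℝ → ℝ} {α β : ℝ} (hαβ : α ≤ β)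
    (hf : BoundedVariationOn f (Set.Icc α β)) : IntervalIntegrable f volume α β := by
  obtain ⟨g, k, hg, hk, rfl⟩ :=
    hf.locallyBoundedVariationOn.exists_monotoneOn_sub_monotoneOn
  rw [← Set.uIcc_of_le hαβ] at hg hk
  exact hg.intervalIntegrable.sub hk.intervalIntegrable

namespace MemV

variable {s : ℕ} {f : ℝ → ℝ} {α β : ℝ}

theorem boundedVariationOn (hf : MemV s f α β) :
    BoundedVariationOn (iteratedDerivWithin s f (Set.Icc α β)) (Set.Icc α β) := by
  cases s with
  | zero => rw [iteratedDerivWithin_zero]; exact hf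
  | succ t => exact hf.2.2

theorem hasDerivWithinAt (hf : MemV s f α β) {i : ℕ} (hi : i < s) {t : ℝ}
    (ht : t ∈ Set.Icc α β) :
    HasDerivWithinAt (iteratedDerivWithin i f (Set.Icc α β))
      (iteratedDerivWithin (i + 1) f (Set.Icc α β) t) (Set.Icc α β) t := by
  cases s with
  | zero => omega
  | succ r =>
    rw [iteratedDerivWithin_succ]
    exact (hf.1 i (by omega) t ht).hasDerivWithinAt

theorem intervalIntegrable (hαβ : α ≤ β) (hf : MemV s f α β) :
    IntervalIntegrable f volume α β := by
  cases s with
  | zero => exact BoundedVariationOn.intervalIntegrable hαβ hf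
  | succ r =>
    have := (hf.1 0 (by omega)).continuousOn
    rw [iteratedDerivWithin_zero] at this
    exact this.intervalIntegrable_of_Icc hαβ

end MemV

/-- **Error bound for compound quadrature formulas** (`w ≡ 1`).  Let
`Q[f] = ∑ j, a j * f (x j)` be a quadrature formula that is exact on all polynomials of
degree at most `m`.  Then for every `s ∈ {0, …, m}` there is a constant `C` (depending
only on `Q` and `s`) such that for every `n ≥ 1` and every `f ∈ V s`, the `n`-fold
compound formula `Q⁽ⁿ⁾[f] = (1/n) ∑_{ν=1}^n ∑_j a j * f (-1 + (x j + 2ν - 1)/n)`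
satisfies `|∫ f - Q⁽ⁿ⁾[f]| ≤ C n^(-s-1) · Var f⁽ˢ⁾`. -/
theorem compound_quadrature_error_bound
    (l : ℕ) (x a : Fin l → ℝ)
    (hx_mono : StrictMono x) (hx_mem : ∀ j, x j ∈ Set.Icc (-1 : ℝ) 1)
    (m : ℕ)
    (h_exact : ∀ p : Polynomial ℝ, p.degree ≤ (m : WithBot ℕ) →
      ∑ j, a j * p.eval (x j) = ∫ t in (-1 : ℝ)..1, p.eval t)
    (s : ℕ) (hs : s ≤ m) :
    ∃ C : ℝ, ∀ n : ℕ, 0 < n → ∀ f : ℝ → ℝ, MemV s f (-1) 1 →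
      |(∫ t in (-1 : ℝ)..1, f t) -
          (1 / (n : ℝ)) * ∑ ν ∈ Finset.Icc 1 n, ∑ j, a j *
            f (-1 + (x j + 2 * (ν : ℝ) - 1) / (n : ℝ))| ≤
        C * ((n : ℝ) ^ (s + 1))⁻¹ *
          totalVar (iteratedDerivWithin s f (Set.Icc (-1) 1)) (-1) 1 := by
  refine ⟨(2 + ∑ j, |a j|) * 2 ^ s, fun n hn f hf => ?_⟩
  set G := fun i => iteratedDerivWithin i f (Set.Icc (-1) 1)
  have hn' : (0 : ℝ) < n := Nat.cast_pos.2 hn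
  let u : ℕ → ℝ := fun k => -1 + 2 * k / n
  let c : ℕ → ℝ := fun k => -1 + (2 * k + 1) / n
  have hu0 : u 0 = -1 := by simp [u]
  have hun : u n = 1 := by simp only [u]; field_simp; norm_num
  have hu : Monotone u := fun i j hij => by simp only [u]; gcongr
  have hul : ∀ k, u k = c k - 1 / n := fun k => by simp only [u, c]; field_simp; ring
  have hur : ∀ k, u (k + 1) = c k + 1 / n := fun k => by
    simp only [u, c]; push_cast; field_simp; ring
  have hsub : ∀ k < n, Set.Icc (u k) (u (k + 1)) ⊆ Set.Icc (-1) 1 := fun k hk =>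
    Set.Icc_subset_Icc (hu0 ▸ hu (Nat.zero_le k)) (hun ▸ hu hk)
  have hV := hf.boundedVariationOn
  have hint : ∀ k < n, IntervalIntegrable f volume (u k) (u (k + 1)) := fun k hk =>
    (hf.intervalIntegrable (by norm_num)).mono_set (by
      rw [Set.uIcc_of_le (hu k.le_succ), Set.uIcc_of_le (by norm_num)]
      exact hsub k hk)
  have hvar : ∑ k ∈ Finset.range n, totalVar (G s) (u k) (u (k + 1)) = totalVar (G s) (-1) 1 := by
    simp only [totalVar]
    rw [← ENNReal.toReal_sum fun k hk => hV.mono (hsub k (Finset.mem_range.1 hk)),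
      eVariationOn.sum' _ hu, hu0, hun]
  have hlocal : ∀ k < n, |(∫ t in (u k)..(u (k + 1)), f t)
      - 1 / n * ∑ j, a j * f (c k + 1 / n * x j)|
      ≤ (2 + ∑ j, |a j|) * (1 / n * (totalVar (G s) (u k) (u (k + 1)) * (2 / n) ^ s)) := by
    intro k hk
    obtain ⟨p, hp, hfp⟩ := exists_polynomial_abs_sub_le (hu k.le_succ) s G
      (fun i hi t ht => (hf.hasDerivWithinAt hi (hsub k hk ht)).mono (hsub k hk))
      (hV.mono (hsub k hk))
    rw [Nat.succ_eq_add_one, show u (k + 1) - u k = 2 / n by rw [hur, hul]; ring] at hfp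
    have hk' := hint k hk
    rw [hur, hul] at hfp hk' ⊢
    refine abs_integral_sub_quadrature_le hx_mem h_exact (by positivity) hk' (hp.trans hs) ?_
    intro t ht
    have := hfp t ht
    rwa [show G 0 = f from iteratedDerivWithin_zero] at this
  have hQ : 1 / (n : ℝ) * ∑ ν ∈ Finset.Icc 1 n, ∑ j, a j *
        f (-1 + (x j + 2 * (ν : ℝ) - 1) / (n : ℝ))
      = ∑ k ∈ Finset.range n, 1 / (n : ℝ) * ∑ j, a j * f (c k + 1 / n * x j) := by
    rw [← Finset.mul_sum, ← Finset.Ico_add_one_right_eq_Icc, Finset.sum_Ico_eq_sum_range,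
      Nat.add_sub_cancel]
    refine congrArg _ (Finset.sum_congr rfl fun k _ => Finset.sum_congr rfl fun j _ => ?_)
    congr 2
    simp only [c]
    push_cast
    ring
  have hI := intervalIntegral.sum_integral_adjacent_intervals hint
  rw [hu0, hun] at hI
  rw [hQ, ← hI, ← Finset.sum_sub_distrib]
  refine (Finset.abs_sum_le_sum_abs _ _).trans
    ((Finset.sum_le_sum fun k hk => hlocal k (Finset.mem_range.1 hk)).trans_eq ?_)
  rw [← Finset.mul_sum, ← Finset.mul_sum, ← Finset.sum_mul, hvar, div_pow]
  simp only [G]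
  field_simp
  ring
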